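/- Let c, q be positive integers with q even, a₁, a₂ units mod c, and 1 ≤ H₁ ≤ H₂ ≤ C·c. Then the number of integer solutions (h₁, …, h_q) with |h_i| ≤ H_j for i ≡ j (mod 2), j ∈ {1,2}, to T^{a₁h₁} S T^{a₂h₂} S ⋯ T^{a₁h_{q−1}} S T^{a₂h_q} S = I in PSL₂(ℤ/cℤ) is at least c_q · (H₂^{(q−2)/2} + (H₁H₂)^{q/2}/c³) for some constant c_q > 0 depending only on q. -/

import Mathlib

open Matrix

/-- The matrix `T = (1 1; 0 1)` in `SL₂(ℤ/cℤ)`. -/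
def Tm (c : ℕ) : SpecialLinearGroup (Fin 2) (ZMod c) :=
  ⟨!![1, 1; 0, 1], by norm_num [Matrix.det_fin_two_of]⟩

/-- The matrix `S = (0 -1; 1 0)` in `SL₂(ℤ/cℤ)`. -/
def Sm (c : ℕ) : SpecialLinearGroup (Fin 2) (ZMod c) :=
  ⟨!![0, -1; 1, 0], by norm_num [Matrix.det_fin_two_of]⟩

/-- ordered product of the first `n` terms -/
def pr {Q : Type*} [Monoid Q] (f : ℕ → Q) : ℕ → Q
  | 0 => 1
  | n + 1 => pr f n * f n

lemma pr_succ' {Q : Type*} [Monoid Q] (f : ℕ → Q) (n : ℕ) :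
    pr f (n + 1) = f 0 * pr (fun i => f (i + 1)) n := by
  induction n with
  | zero => simp [pr]
  | succ n ih => rw [pr, ih, pr, mul_assoc]

lemma pr_add {Q : Type*} [Monoid Q] (f : ℕ → Q) (m n : ℕ) :
    pr f (m + n) = pr f m * pr (fun i => f (m + i)) n := by
  induction n with
  | zero => simp [pr]
  | succ n ih => rw [← add_assoc, pr, ih, pr, mul_assoc]

lemma pr_congr {Q : Type*} [Monoid Q] {f g : ℕ → Q} {n : ℕ} (h : ∀ i < n, f i = g i) :
    pr f n = pr g n := by
  induction n with
  | zero => simp [pr]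
  | succ n ih => rw [pr, pr, ih (fun i hi => h i (by omega)), h n (by omega)]

lemma pr_pair {Q : Type*} [Monoid Q] (f : ℕ → Q) (n : ℕ) :
    pr f (2 * n) = pr (fun i => f (2 * i) * f (2 * i + 1)) n := by
  induction n with
  | zero => simp [pr]
  | succ n ih =>
    rw [show 2 * (n + 1) = 2 * n + 1 + 1 by ring, pr, pr, pr, ih, mul_assoc]

lemma pr_ofFn {Q : Type*} [Monoid Q] (n : ℕ) (f : ℕ → Q) :
    (List.ofFn (fun i : Fin n => f i)).prod = pr f n := by
  induction n generalizing f with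
  | zero => simp [pr]
  | succ n ih =>
    rw [List.ofFn_succ, List.prod_cons, pr_succ', ← ih]
    simp

lemma map_pr {Q P : Type*} [Monoid Q] [Monoid P] (φ : Q →* P) (f : ℕ → Q) (n : ℕ) :
    φ (pr f n) = pr (fun i => φ (f i)) n := by
  induction n with
  | zero => simp [pr]
  | succ n ih => simp [pr, ih]

lemma pr_rev {Q : Type*} [Group Q] (s : Q) (hs : s * s = 1) (u : ℕ → Q) (m : ℕ) :
    s * pr (fun i => (u (m - 1 - i))⁻¹ * s) m = (pr (fun i => u i * s) m)⁻¹ * s := by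
  induction m with
  | zero => simp [pr]
  | succ m ih =>
    have hs' : s⁻¹ = s := inv_eq_of_mul_eq_one_left hs
    rw [pr_succ', pr, _root_.mul_inv_rev, _root_.mul_inv_rev, hs']
    have : pr (fun i => (u (m + 1 - 1 - (i + 1)))⁻¹ * s) m
        = pr (fun i => (u (m - 1 - i))⁻¹ * s) m :=
      pr_congr (fun i hi => by congr 3; omega)
    rw [this, mul_assoc s _ (pr _ _ )⁻¹, mul_assoc s, mul_assoc _ (pr _ _)⁻¹, ← ih]
    simp [mul_assoc]

/-- letters of the word -/
def ltr {Q : Type*} [Group Q] (t s : Q) (a : ℕ → ℤ) (h : ℕ → ℤ) (i : ℕ) : Q :=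
  t ^ (a i * h i) * s

/-- extension by zero -/
def ext0 {n : ℕ} (h : Fin n → ℤ) (i : ℕ) : ℤ := if hi : i < n then h ⟨i, hi⟩ else 0

/-- glue two half words -/
def glue (k : ℕ) (x y : ℕ → ℤ) (i : ℕ) : ℤ :=
  if i = 0 then x 0 - y 0 else if i < k then x i else if i = k then x k - y k
  else - y (2 * k - i)

/-- half word -/
def half {Q : Type*} [Group Q] (t s : Q) (a : ℕ → ℤ) (k : ℕ) (x : ℕ → ℤ) : Q :=
  pr (ltr t s a x) k * t ^ (a k * x k)

lemma glue_word {Q : Type*} [Group Q] (t s : Q) (hs : s * s = 1) (a : ℕ → ℤ)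
    (ha : ∀ i j, i % 2 = j % 2 → a i = a j) (m : ℕ) (x y : ℕ → ℤ)
    (h : half t s a (m + 1) x = half t s a (m + 1) y) :
    pr (ltr t s a (glue (m + 1) x y)) (2 * (m + 1)) = 1 := by
  have key (z : ℕ → ℤ) : half t s a (m + 1) z =
      t ^ (a 0 * z 0) * s * pr (fun i => t ^ (a (i + 1) * z (i + 1)) * s) m
        * t ^ (a (m + 1) * z (m + 1)) := by
    rw [half, pr_succ']; rfl
  rw [key, key] at h
  rw [two_mul, pr_add, pr_succ', pr_succ']
  have e1 : pr (fun i => ltr t s a (glue (m + 1) x y) (i + 1)) m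
      = pr (fun i => t ^ (a (i + 1) * x (i + 1)) * s) m :=
    pr_congr (fun i hi => by simp [ltr, glue, hi])
  have e2 : pr (fun i => ltr t s a (glue (m + 1) x y) (m + 1 + (i + 1))) m
      = pr (fun i => (t ^ (a (m - 1 - i + 1) * y (m - 1 - i + 1)))⁻¹ * s) m :=
    pr_congr (fun i hi => by
      have h1 : a (m + 1 + (i + 1)) = a (m - 1 - i + 1) := ha _ _ (by omega)
      have h2 : glue (m + 1) x y (m + 1 + (i + 1)) = - y (m - 1 - i + 1) := by
        rw [glue, if_neg (by omega), if_neg (by omega), if_neg (by omega)]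
        congr 2; omega
      rw [ltr, h1, h2, ← _root_.zpow_neg]; congr 2; ring)
  have e3 := pr_rev s hs (fun i => t ^ (a (i + 1) * y (i + 1))) m
  rw [e1, e2]
  generalize pr (fun i => t ^ (a (i + 1) * x (i + 1)) * s) m = A at *
  generalize pr (fun i => t ^ (a (i + 1) * y (i + 1)) * s) m = B at *
  have l0 : ltr t s a (glue (m + 1) x y) 0
      = (t ^ (a 0 * y 0))⁻¹ * t ^ (a 0 * x 0) * s := by
    rw [ltr, ← _root_.zpow_neg, ← _root_.zpow_add]; congr 2; simp [glue]; ring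
  have lk : ltr t s a (glue (m + 1) x y) (m + 1 + 0)
      = t ^ (a (m + 1) * x (m + 1)) * (t ^ (a (m + 1) * y (m + 1)))⁻¹ * s := by
    rw [ltr, ← _root_.zpow_neg, ← _root_.zpow_add]; congr 2; simp [glue]; ring
  rw [l0, lk, mul_assoc _ s (pr _ _), e3]
  calc _ = (t ^ (a 0 * y 0))⁻¹ * (t ^ (a 0 * x 0) * s * A * t ^ (a (m + 1) * x (m + 1)))
        * (t ^ (a (m + 1) * y (m + 1)))⁻¹ * B⁻¹ * s := by simp only [mul_assoc]
    _ = _ := by rw [h]; simp [mul_assoc, hs]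

/-- solutions -/
def Sol {Q : Type*} [Group Q] (t s : Q) (a : ℕ → ℤ) (H : ℕ → ℝ) (n : ℕ) : Set (Fin n → ℤ) :=
  {h | (∀ i : Fin n, |(h i : ℝ)| ≤ H i) ∧ pr (ltr t s a (ext0 h)) n = 1}

lemma mem_box (H : ℝ) (x : ℤ) : x ∈ Finset.Icc (-⌊H⌋) ⌊H⌋ ↔ |(x : ℝ)| ≤ H := by
  rw [Finset.mem_Icc, abs_le, Int.le_floor, neg_le, Int.le_floor]
  push_cast
  constructor <;> rintro ⟨h, h'⟩ <;> constructor <;> linarith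

lemma card_box (H : ℝ) (h : 0 ≤ H) : H ≤ ((Finset.Icc (-⌊H⌋) ⌊H⌋).card : ℝ) := by
  have h1 : (0 : ℤ) ≤ ⌊H⌋ := Int.floor_nonneg.2 h
  have h2 := Int.lt_floor_add_one H
  have h3 : ((Finset.Icc (-⌊H⌋) ⌊H⌋).card : ℤ) = 2 * ⌊H⌋ + 1 := by
    rw [Int.card_Icc]; omega
  have h4 : ((Finset.Icc (-⌊H⌋) ⌊H⌋).card : ℝ) = 2 * ⌊H⌋ + 1 := by exact_mod_cast h3
  have h5 : (0 : ℝ) ≤ ⌊H⌋ := by exact_mod_cast h1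
  linarith

lemma sol_finite {Q : Type*} [Group Q] (t s : Q) (a : ℕ → ℤ) (H : ℕ → ℝ) (n : ℕ) :
    (Sol t s a H n).Finite := by
  apply (Fintype.piFinset (fun i : Fin n => Finset.Icc (-⌊H i⌋) ⌊H i⌋)).finite_toSet.subset
  intro h hh
  simp only [Finset.mem_coe, Fintype.mem_piFinset]
  exact fun i => (mem_box _ _).2 (hh.1 i)

lemma cs {X Q : Type*} [DecidableEq Q] [Fintype Q] (B : Finset X) (w : X → Q) :
    B.card ^ 2 ≤ Fintype.card Q * ((B ×ˢ B).filter (fun p => w p.1 = w p.2)).card := by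
  classical
  have h1 : B.card = ∑ g : Q, (B.filter (fun x => w x = g)).card :=
    Finset.card_eq_sum_card_fiberwise (fun x _ => by simp)
  have h2 : ((B ×ˢ B).filter (fun p => w p.1 = w p.2)).card
      = ∑ g : Q, (B.filter (fun x => w x = g)).card ^ 2 := by
    rw [Finset.card_eq_sum_card_fiberwise (f := fun p => w p.1) (t := Finset.univ)
      (fun x _ => by simp)]
    refine Finset.sum_congr rfl fun g _ => ?_
    rw [sq, ← Finset.card_product]
    congr 1
    ext p
    simp only [Finset.mem_filter, Finset.mem_product]
    constructor
    · rintro ⟨⟨⟨a, b⟩, c⟩, d⟩; exact ⟨⟨a, d⟩, b, c ▸ d⟩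
    · rintro ⟨⟨a, b⟩, c, d⟩; exact ⟨⟨⟨a, c⟩, b.trans d.symm⟩, b⟩
  rw [h1, h2]
  exact sq_sum_le_card_mul_sum_sq

lemma ext0_of {n : ℕ} (h : Fin n → ℤ) (i : ℕ) (hi : i < n) : ext0 h i = h ⟨i, hi⟩ := by
  simp [ext0, hi]

lemma partB {Q : Type*} [Group Q] [Fintype Q] (t s : Q) (hs : s * s = 1) (a : ℕ → ℤ)
    (ha : ∀ i j, i % 2 = j % 2 → a i = a j) (H : ℕ → ℝ)
    (hH : ∀ i j, i % 2 = j % 2 → H i = H j) (H0 : ∀ i, 0 < H i) (m : ℕ) :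
    ∏ i ∈ Finset.range (m + 1), (H i / 2 * (H (i + 1) / 2)) ≤
      Fintype.card Q * (Nat.card (Sol t s a H (2 * (m + 1))) : ℝ) := by
  classical
  set I : ℕ → Finset ℤ := fun i => Finset.Icc (-⌊H i / 2⌋) ⌊H i / 2⌋ with hI
  set X : Finset (Fin (m + 2) → ℤ) := Fintype.piFinset (fun i => I i) with hX
  set w : (Fin (m + 2) → ℤ) → Q := fun x => half t s a (m + 1) (ext0 x) with hw
  have hcs := cs X w
  have hXc : X.card = ∏ i ∈ Finset.range (m + 2), (I i).card := by
    rw [hX, Fintype.card_piFinset, Finset.prod_range]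
  set P := (X ×ˢ X).filter (fun p => w p.1 = w p.2) with hP
  have memX (x) (hx : x ∈ X) (i : ℕ) (hi : i < m + 2) : ext0 x i ∈ I i := by
    rw [ext0_of x i hi]; exact Fintype.mem_piFinset.1 hx ⟨i, hi⟩
  have hinj : P.card ≤ Nat.card (Sol t s a H (2 * (m + 1))) * ((I 0).card * (I (m + 1)).card) := by
    have := (sol_finite t s a H (2 * (m + 1))).to_subtype
    have : Nat.card P ≤ Nat.card (Sol t s a H (2 * (m + 1)) × (I 0 × I (m + 1))) := by
      have hmem (p : P) : p.1.1 ∈ X ∧ p.1.2 ∈ X ∧ w p.1.1 = w p.1.2 := by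
        have := p.2
        simp only [hP, Finset.mem_filter, Finset.mem_product] at this
        tauto
      have hsol (p : P) : (fun i : Fin (2 * (m + 1)) => glue (m + 1) (ext0 p.1.1) (ext0 p.1.2) i)
          ∈ Sol t s a H (2 * (m + 1)) := by
        obtain ⟨h1, h2, h3⟩ := hmem p
        constructor
        · intro i
          have b1 (j : ℕ) (hj : j < m + 2) := (mem_box _ _).1 (memX _ h1 j hj)
          have b2 (j : ℕ) (hj : j < m + 2) := (mem_box _ _).1 (memX _ h2 j hj)
          have hi := i.2
          have := H0 i
          simp only [glue]
          split_ifs with c1 c2 c3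
          · have := b1 0 (by omega)
            have := b2 0 (by omega)
            rw [c1]; push_cast
            refine (abs_sub _ _).trans ?_
            linarith
          · have := b1 i (by omega)
            linarith
          · have := b1 (m + 1) (by omega)
            have := b2 (m + 1) (by omega)
            rw [c3]; push_cast
            refine (abs_sub _ _).trans ?_
            linarith
          · have := b2 (2 * (m + 1) - i) (by omega)
            rw [hH (2 * (m + 1) - i) i (by omega)] at this
            push_cast
            rw [abs_neg]
            linarith
        · rw [← glue_word t s hs a ha m _ _ h3]
          refine pr_congr fun i hi => ?_
          rw [ltr, ltr, ext0_of _ i hi]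
      refine Nat.card_le_card_of_injective
        (fun p : P => ((⟨_, hsol p⟩ : Sol t s a H (2 * (m + 1))),
          ((⟨ext0 p.1.2 0, memX _ (hmem p).2.1 0 (by omega)⟩ : I 0),
          (⟨ext0 p.1.2 (m + 1), memX _ (hmem p).2.1 (m + 1) (by omega)⟩ : I (m + 1))))) ?_
      intro p p' hpp
      simp only [Prod.mk.injEq, Subtype.mk.injEq] at hpp
      obtain ⟨g, g0, gk⟩ := hpp
      have gg (i : ℕ) (hi : i < 2 * (m + 1)) := congrFun g ⟨i, hi⟩
      simp only [glue] at gg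
      have y (i : ℕ) (hi : i < m + 2) : ext0 p.1.2 i = ext0 p'.1.2 i := by
        by_cases c1 : i = 0
        · rw [c1, g0]
        by_cases c2 : i = m + 1
        · rw [c2, gk]
        have := gg (2 * (m + 1) - i) (by omega)
        rw [if_neg (by omega), if_neg (by omega), if_neg (by omega), if_neg (by omega),
          if_neg (by omega), if_neg (by omega),
          show 2 * (m + 1) - (2 * (m + 1) - i) = i by omega] at this
        linarith
      have x (i : ℕ) (hi : i < m + 2) : ext0 p.1.1 i = ext0 p'.1.1 i := by
        have := gg i (by omega)
        have y0 := y 0 (by omega)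
        have yk := y (m + 1) (by omega)
        split_ifs at this with c1 c2 c3
        · subst c1; linarith
        · exact this
        · subst c3; linarith
        · omega
      apply Subtype.ext
      apply Prod.ext
      · funext i
        have := x i i.2
        rwa [ext0_of _ _ i.2, ext0_of _ _ i.2] at this
      · funext i
        have := y i i.2
        rwa [ext0_of _ _ i.2, ext0_of _ _ i.2] at this
    simpa [Nat.card_prod] using this
  have hIc (i : ℕ) : H i / 2 ≤ ((I i).card : ℝ) := card_box _ (by have := H0 i; linarith)
  have hIp (i : ℕ) : (0 : ℝ) < (I i).card := lt_of_lt_of_le (by have := H0 i; linarith) (hIc i)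
  have hsq : X.card ^ 2 = (∏ i ∈ Finset.range (m + 1), ((I i).card * (I (i + 1)).card)) *
      ((I 0).card * (I (m + 1)).card) := by
    rw [sq, Finset.prod_mul_distrib]
    have p1 := hXc
    rw [Finset.prod_range_succ] at p1
    have p2 := hXc
    rw [Finset.prod_range_succ'] at p2
    nth_rewrite 1 [p1]
    rw [p2]
    ring
  calc ∏ i ∈ Finset.range (m + 1), (H i / 2 * (H (i + 1) / 2))
      ≤ ∏ i ∈ Finset.range (m + 1), (((I i).card : ℝ) * (I (i + 1)).card) := by
        apply Finset.prod_le_prod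
        · intro i _
          have := H0 i
          have := H0 (i + 1)
          positivity
        · intro i _
          have := H0 i
          have := H0 (i + 1)
          exact mul_le_mul (hIc i) (hIc _) (by positivity) (hIp i).le
    _ ≤ _ := by
        have hpos : (0 : ℝ) < (I 0).card * (I (m + 1)).card := mul_pos (hIp _) (hIp _)
        refine le_of_mul_le_mul_right ?_ hpos
        have h1 := hcs.trans (Nat.mul_le_mul_left _ hinj)
        rw [hsq] at h1
        rw [mul_assoc]
        exact_mod_cast h1

lemma partA {Q : Type*} [Group Q] (t s : Q) (hs : s * s = 1) (a : ℕ → ℤ)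
    (ha : ∀ i j, i % 2 = j % 2 → a i = a j) (H : ℕ → ℝ)
    (hH : ∀ i j, i % 2 = j % 2 → H i = H j) (H0 : ∀ i, 0 < H i) (m : ℕ) :
    (H 1 / (m + 1)) ^ m ≤ (Nat.card (Sol t s a H (2 * (m + 1))) : ℝ) := by
  classical
  set I : Finset ℤ := Finset.Icc (-⌊H 1 / (m + 1)⌋) ⌊H 1 / (m + 1)⌋ with hI
  set X : Finset (Fin m → ℤ) := Fintype.piFinset (fun _ => I) with hX
  have hXc : X.card = I.card ^ m := by simp [hX]
  have := (sol_finite t s a H (2 * (m + 1))).to_subtype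
  let g : (Fin m → ℤ) → ℕ → ℤ := fun x i =>
    if i % 2 = 0 then 0 else if i = 2 * m + 1 then - ∑ j, x j else ext0 x (i / 2)
  have word (x : Fin m → ℤ) : pr (ltr t s a (g x)) (2 * (m + 1)) = 1 := by
    have step (n : ℕ) (hn : n ≤ m) : pr (ltr t s a (g x)) (2 * n)
        = s * t ^ (a 1 * ∑ j ∈ Finset.range n, ext0 x j) * s := by
      induction n with
      | zero => simp [pr, hs]
      | succ n ih =>
        rw [show 2 * (n + 1) = 2 * n + 1 + 1 by ring, pr, pr, ih (by omega)]
        have e1 : ltr t s a (g x) (2 * n) = s := by simp [ltr, g]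
        have e2 : ltr t s a (g x) (2 * n + 1) = t ^ (a 1 * ext0 x n) * s := by
          rw [ltr, ha (2 * n + 1) 1 (by omega)]
          congr 3
          simp only [g]
          rw [if_neg (by omega), if_neg (by omega)]
          congr 1; omega
        rw [e1, e2, Finset.sum_range_succ, mul_add, _root_.zpow_add]
        simp only [mul_assoc]
        rw [← mul_assoc s s, hs, one_mul]
    rw [show 2 * (m + 1) = 2 * m + 1 + 1 by ring, pr, pr, step m le_rfl]
    have e1 : ltr t s a (g x) (2 * m) = s := by simp [ltr, g]
    have e2 : ltr t s a (g x) (2 * m + 1) = t ^ (a 1 * - ∑ j, x j) * s := by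
      rw [ltr, ha (2 * m + 1) 1 (by omega)]
      congr 3
      simp only [g]
      simp
    have e3 : ∑ j ∈ Finset.range m, ext0 x j = ∑ j, x j := by
      rw [Finset.sum_range]
      exact Finset.sum_congr rfl fun j _ => ext0_of x j j.2
    rw [e1, e2, e3, mul_neg, _root_.zpow_neg]
    simp only [mul_assoc]
    rw [← mul_assoc s s, hs, one_mul, mul_inv_cancel_left, hs]
  have hm : (0 : ℝ) < m + 1 := by positivity
  have hsol (x : X) : (fun i : Fin (2 * (m + 1)) => g x.1 i) ∈ Sol t s a H (2 * (m + 1)) := by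
    have hx (j : Fin m) : |((x.1 j : ℤ) : ℝ)| ≤ H 1 / (m + 1) :=
      (mem_box _ _).1 (Fintype.mem_piFinset.1 x.2 j)
    constructor
    · intro i
      have hi := i.2
      simp only [g]
      split_ifs with c1 c2
      · simpa using (H0 i).le
      · rw [hH i 1 (by omega)]
        push_cast
        rw [abs_neg]
        refine (Finset.abs_sum_le_sum_abs _ _).trans ?_
        refine (Finset.sum_le_sum fun j _ => hx j).trans ?_
        simp only [Finset.sum_const, Finset.card_univ, Fintype.card_fin, nsmul_eq_mul]
        rw [mul_div_assoc', div_le_iff₀ hm]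
        have := H0 1
        nlinarith
      · rw [ext0_of _ _ (by omega : (i : ℕ) / 2 < m), hH i 1 (by omega)]
        refine (hx _).trans (div_le_self (H0 1).le ?_)
        have : (0 : ℝ) ≤ m := by positivity
        linarith
    · rw [← word x.1]
      refine pr_congr fun i hi => ?_
      rw [ltr, ltr, ext0_of _ i hi]
  have hc : Nat.card X ≤ Nat.card (Sol t s a H (2 * (m + 1))) := by
    refine Nat.card_le_card_of_injective (fun x : X => (⟨_, hsol x⟩ : Sol t s a H _)) ?_
    intro x x' hxx
    simp only [Subtype.mk.injEq] at hxx
    apply Subtype.ext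
    funext j
    have hj := j.2
    have := congrFun hxx ⟨2 * j + 1, by omega⟩
    simp only [g] at this
    rw [if_neg (by omega), if_neg (by omega), if_neg (by omega), if_neg (by omega),
      show (2 * (j : ℕ) + 1) / 2 = j by omega, ext0_of _ _ hj, ext0_of _ _ hj] at this
    exact this
  have hpos : 0 ≤ H 1 / (m + 1) := by have := H0 1; positivity
  calc (H 1 / (m + 1)) ^ m ≤ (I.card : ℝ) ^ m := pow_le_pow_left₀ hpos (card_box _ hpos) _
    _ = (Nat.card X : ℝ) := by simp [hXc]
    _ ≤ _ := by exact_mod_cast hc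

lemma card_SL (c : ℕ) [NeZero c] : Nat.card (SpecialLinearGroup (Fin 2) (ZMod c)) ≤ c ^ 3 := by
  classical
  let col : (Matrix.SpecialLinearGroup (Fin 2) (ZMod c)) → ZMod c × ZMod c := fun M => (M.1 0 0, M.1 1 0)
  let rep : ZMod c × ZMod c → (Matrix.SpecialLinearGroup (Fin 2) (ZMod c)) := Function.invFun col
  have hrep (M : (Matrix.SpecialLinearGroup (Fin 2) (ZMod c))) : col (rep (col M)) = col M := Function.invFun_eq ⟨M, rfl⟩
  have hinj : Function.Injective (fun M : (Matrix.SpecialLinearGroup (Fin 2) (ZMod c)) => (col M, ((rep (col M))⁻¹ * M).1 0 1)) := by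
    intro M N h
    simp only [Prod.mk.injEq] at h
    obtain ⟨h1, h2⟩ := h
    have r1 := hrep M
    have r2 := r1.trans h1
    rw [← h1] at h2
    generalize rep (col M) = R at *
    obtain ⟨r1a, r1b⟩ := Prod.ext_iff.1 r1
    obtain ⟨r2a, r2b⟩ := Prod.ext_iff.1 r2
    change R.1 0 0 = M.1 0 0 at r1a
    change R.1 1 0 = M.1 1 0 at r1b
    change R.1 0 0 = N.1 0 0 at r2a
    change R.1 1 0 = N.1 1 0 at r2b
    have dR := R.2
    have dM := M.2
    have dN := N.2
    rw [Matrix.det_fin_two] at dR dM dN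
    change ((R⁻¹).1 * M.1) 0 1 = ((R⁻¹).1 * N.1) 0 1 at h2
    rw [Matrix.mul_apply, Matrix.mul_apply, Fin.sum_univ_two, Fin.sum_univ_two,
      Matrix.SpecialLinearGroup.SL2_inv_expl] at h2
    change R.1 1 1 * M.1 0 1 + -(R.1 0 1) * M.1 1 1
      = R.1 1 1 * N.1 0 1 + -(R.1 0 1) * N.1 1 1 at h2
    rw [← r1a, ← r1b] at dM
    rw [← r2a, ← r2b] at dN
    ext i j
    fin_cases i <;> fin_cases j
    · exact r1a.symm.trans r2a
    · simp
      linear_combination (-(M.1 0 1) + N.1 0 1) * dR + R.1 0 0 * h2 + R.1 0 1 * dM - R.1 0 1 * dN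
    · exact r1b.symm.trans r2b
    · simp
      linear_combination (-(M.1 1 1) + N.1 1 1) * dR + R.1 1 0 * h2 + R.1 1 1 * dM - R.1 1 1 * dN
  have := Nat.card_le_card_of_injective _ hinj
  simp only [Nat.card_prod, Nat.card_zmod] at this
  calc _ ≤ _ := this
    _ = c ^ 3 := by ring

/-- **lower bound.** Let `q = 2k` be even, `a₁, a₂` units mod `c`, and
`1 ≤ H₁ ≤ H₂ ≤ C₀·c`. Then the number of integer solutions `(h₁, …, h_q)` with
`|hᵢ| ≤ H₁` for odd `i`, `|hᵢ| ≤ H₂` for even `i` to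
`T^{a₁h₁} S T^{a₂h₂} S ⋯ T^{a₁h_{q-1}} S T^{a₂h_q} S = I` in `PSL₂(ℤ/cℤ)` is at
least `c_q (H₂^{(q-2)/2} + (H₁H₂)^{q/2}/c³)` for a constant `c_q > 0` depending only
on `q` (and the implied constant `C₀`). -/
theorem stmt13 : ∀ k : ℕ, 1 ≤ k → ∀ C₀ : ℝ, 1 ≤ C₀ → ∃ C : ℝ, 0 < C ∧
    ∀ (c : ℕ), 0 < c → ∀ (a₁ a₂ : ℤ),
      IsUnit ((a₁ : ZMod c)) → IsUnit ((a₂ : ZMod c)) →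
      ∀ H₁ H₂ : ℝ, 1 ≤ H₁ → H₁ ≤ H₂ → H₂ ≤ C₀ * (c : ℝ) →
      C * (H₂ ^ (k - 1) + (H₁ * H₂) ^ k / (c : ℝ) ^ 3) ≤
        (Nat.card {h : Fin (2 * k) → ℤ //
          (∀ i : Fin (2 * k),
            ((i : ℕ) % 2 = 0 → (|h i| : ℝ) ≤ H₁) ∧ ((i : ℕ) % 2 = 1 → (|h i| : ℝ) ≤ H₂)) ∧
          ∃ γ : ZMod c, γ ^ 2 = 1 ∧
            ((List.ofFn (fun i : Fin k =>
                (Tm c) ^ (a₁ * h ⟨2 * i.1, by have := i.2; omega⟩) * Sm c *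
                  (Tm c) ^ (a₂ * h ⟨2 * i.1 + 1, by have := i.2; omega⟩) * Sm c)).prod).1
              = γ • (1 : Matrix (Fin 2) (Fin 2) (ZMod c))} : ℝ) := by
  intro k hk C₀ _
  obtain ⟨m, rfl⟩ : ∃ m, k = m + 1 := ⟨k - 1, by omega⟩
  refine ⟨min ((1 / ((m : ℝ) + 1)) ^ m) ((1 / 4) ^ (m + 1)) / 2, by positivity, ?_⟩
  intro c hc a₁ a₂ _ _ H₁ H₂ h1 h12 _
  have : NeZero c := ⟨hc.ne'⟩
  let Q := (Matrix.SpecialLinearGroup (Fin 2) (ZMod c)) ⧸ Subgroup.center (Matrix.SpecialLinearGroup (Fin 2) (ZMod c))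
  let φ : (Matrix.SpecialLinearGroup (Fin 2) (ZMod c)) →* Q := QuotientGroup.mk' (Subgroup.center (Matrix.SpecialLinearGroup (Fin 2) (ZMod c)))
  have : Finite Q := inferInstance
  have : Fintype Q := Fintype.ofFinite Q
  have hφ (A : (Matrix.SpecialLinearGroup (Fin 2) (ZMod c))) : φ A = 1 ↔ ∃ γ : ZMod c, γ ^ 2 = 1 ∧
      A.1 = γ • (1 : Matrix (Fin 2) (Fin 2) (ZMod c)) := by
    rw [QuotientGroup.mk'_apply, QuotientGroup.eq_one_iff, Matrix.SpecialLinearGroup.mem_center_iff]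
    simp only [Fintype.card_fin, scalar_apply, smul_one_eq_diagonal]
    exact exists_congr fun γ => and_congr_right fun _ => eq_comm
  have hs : φ (Sm c) * φ (Sm c) = 1 := by
    rw [← map_mul, hφ]
    refine ⟨-1, by ring, ?_⟩
    change (Sm c).1 * (Sm c).1 = _
    ext i j
    fin_cases i <;> fin_cases j <;> simp [Sm, Matrix.mul_apply, Fin.sum_univ_two]
  set a : ℕ → ℤ := fun i => if i % 2 = 0 then a₁ else a₂ with ha
  set H : ℕ → ℝ := fun i => if i % 2 = 0 then H₁ else H₂ with hH
  have ha' : ∀ i j, i % 2 = j % 2 → a i = a j := fun i j h => by simp only [ha, h]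
  have hH' : ∀ i j, i % 2 = j % 2 → H i = H j := fun i j h => by simp only [hH, h]
  have H0 : ∀ i, 0 < H i := fun i => by
    simp only [hH]; split_ifs <;> linarith
  have hA := partA (φ (Tm c)) (φ (Sm c)) hs a ha' H hH' H0 m
  have hB := partB (φ (Tm c)) (φ (Sm c)) hs a ha' H hH' H0 m
  have hcard : (Fintype.card Q : ℝ) ≤ (c : ℝ) ^ 3 := by
    have h2 : Nat.card Q ≤ Nat.card (Matrix.SpecialLinearGroup (Fin 2) (ZMod c)) :=
      Nat.card_le_card_of_surjective φ (QuotientGroup.mk'_surjective _)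
    rw [Nat.card_eq_fintype_card] at h2
    exact_mod_cast h2.trans (card_SL c)
  have hset : Nat.card (Sol (φ (Tm c)) (φ (Sm c)) a H (2 * (m + 1))) =
      Nat.card {h : Fin (2 * (m + 1)) → ℤ //
          (∀ i : Fin (2 * (m + 1)),
            ((i : ℕ) % 2 = 0 → (|h i| : ℝ) ≤ H₁) ∧ ((i : ℕ) % 2 = 1 → (|h i| : ℝ) ≤ H₂)) ∧
          ∃ γ : ZMod c, γ ^ 2 = 1 ∧
            ((List.ofFn (fun i : Fin (m + 1) =>
                (Tm c) ^ (a₁ * h ⟨2 * i.1, by have := i.2; omega⟩) * Sm c *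
                  (Tm c) ^ (a₂ * h ⟨2 * i.1 + 1, by have := i.2; omega⟩) * Sm c)).prod).1
              = γ • (1 : Matrix (Fin 2) (Fin 2) (ZMod c))} := by
    refine Nat.card_congr (Equiv.subtypeEquivRight fun h => ?_)
    refine and_congr (forall_congr' fun i => ?_) ?_
    · simp only [hH]
      rcases Nat.mod_two_eq_zero_or_one i with hi | hi <;> simp [hi]
    · rw [← hφ]
      have e : (List.ofFn (fun i : Fin (m + 1) =>
                (Tm c) ^ (a₁ * h ⟨2 * i.1, by have := i.2; omega⟩) * Sm c *
                  (Tm c) ^ (a₂ * h ⟨2 * i.1 + 1, by have := i.2; omega⟩) * Sm c)).prod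
          = pr (ltr (Tm c) (Sm c) a (ext0 h)) (2 * (m + 1)) := by
        rw [pr_pair, ← pr_ofFn]
        congr 2
        funext i
        have hi := i.2
        rw [ltr, ltr, ext0_of h (2 * i) (by omega), ext0_of h (2 * i + 1) (by omega)]
        simp only [ha]
        rw [if_pos (by omega), if_neg (by omega), ← mul_assoc]
      rw [e, map_pr]
      have e' : (fun i => φ (ltr (Tm c) (Sm c) a (ext0 h) i))
          = ltr (φ (Tm c)) (φ (Sm c)) a (ext0 h) := by
        funext i
        simp only [ltr, map_mul, map_zpow]
      rw [e']
  rw [← hset]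
  generalize (Nat.card (Sol (φ (Tm c)) (φ (Sm c)) a H (2 * (m + 1))) : ℝ) = N at *
  have hc0 : (0 : ℝ) < (c : ℝ) ^ 3 := by positivity
  have hHH : ∏ i ∈ Finset.range (m + 1), (H i / 2 * (H (i + 1) / 2))
      = (1 / 4) ^ (m + 1) * (H₁ * H₂) ^ (m + 1) := by
    rw [← mul_pow]
    rw [Finset.prod_congr rfl (g := fun _ => 1 / 4 * (H₁ * H₂)), Finset.prod_const,
      Finset.card_range]
    intro i _
    simp only [hH]
    rcases Nat.mod_two_eq_zero_or_one i with hi | hi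
    · rw [if_pos hi, if_neg (by omega)]; ring
    · rw [if_neg (by omega), if_pos (by omega)]; ring
  have hH1 : H 1 = H₂ := by simp [hH]
  rw [hH1, div_eq_mul_one_div, mul_pow, mul_comm] at hA
  have p1 : 0 < H₁ := by linarith
  have p2 : 0 < H₂ := by linarith
  have hN : 0 ≤ N := le_trans (by positivity) hA
  have hB' : (1 / 4) ^ (m + 1) * ((H₁ * H₂) ^ (m + 1) / (c : ℝ) ^ 3) ≤ N := by
    rw [mul_div_assoc', div_le_iff₀ hc0, ← hHH]
    refine hB.trans ?_
    rw [mul_comm N]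
    exact mul_le_mul_of_nonneg_right hcard hN
  have hp1 : 0 ≤ H₂ ^ m := by positivity
  have hp2 : 0 ≤ (H₁ * H₂) ^ (m + 1) / (c : ℝ) ^ 3 := by positivity
  have k1 := mul_le_mul_of_nonneg_right
    (min_le_left ((1 / ((m : ℝ) + 1)) ^ m) ((1 / 4) ^ (m + 1))) hp1
  have k2 := mul_le_mul_of_nonneg_right
    (min_le_right ((1 / ((m : ℝ) + 1)) ^ m) ((1 / 4) ^ (m + 1))) hp2
  rw [Nat.add_sub_cancel]
  linarith
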